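/- Let μ be a finite real Radon measure on ℝ². For t > 0 set ω₀(·,t) = e^{tΔ}μ and u₀(·,t) = K * ω₀(·,t), and define (Fω₀)(t)(x) = ∫₀ᵗ ∫_{ℝ²} Φ_{t−s}(x−y) u₀(y,s)·∇ω₀(y,s) dy ds. Then for every p ∈ [1,∞], limsup_{t→0⁺} t^{1−1/p} ‖(Fω₀)(t)‖_{L^p(ℝ²)} = 0. -/

import Mathlib

open MeasureTheory Filter Real
open scoped ENNReal Topology

noncomputable section

abbrev R2 := EuclideanSpace ℝ (Fin 2)

/-- `x^⊥ = (-x₂, x₁)`. -/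
def perp (x : R2) : R2 := (WithLp.equiv 2 (Fin 2 → ℝ)).symm ![-x 1, x 0]

/-- Biot–Savart velocity `u = K * ω`. -/
def biotSavart (ω : R2 → ℝ) (x : R2) : R2 :=
  (2 * π)⁻¹ • ∫ y : R2, (ω y / ‖x - y‖ ^ 2) • perp (x - y)

/-- Heat kernel on `ℝ²`. -/
def heatKernel (t : ℝ) (x : R2) : ℝ := (4 * π * t)⁻¹ * Real.exp (-‖x‖ ^ 2 / (4 * t))

/-- Total variation norm of a finite signed measure. -/
def tvNorm (μ : SignedMeasure R2) : ℝ≥0∞ := μ.totalVariation Set.univ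

/-- Integral of a function against a signed measure. -/
def sIntegral (μ : SignedMeasure R2) (f : R2 → ℝ) : ℝ :=
  (∫ x, f x ∂μ.toJordanDecomposition.posPart) - ∫ x, f x ∂μ.toJordanDecomposition.negPart

/-- Heat extension `e^{tΔ}μ` of a signed measure. -/
def heatExt (μ : SignedMeasure R2) (t : ℝ) (x : R2) : ℝ :=
  sIntegral μ (fun y => heatKernel t (x - y))

/-- The Duhamel term
`(Fω₀)(t)(x) = ∫₀ᵗ ∫ Φ_{t-s}(x-y) (u₀·∇ω₀)(y,s) dy ds`,
where `ω₀(·,s) = e^{sΔ}μ` and `u₀(·,s) = K * ω₀(·,s)`. -/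
def Fheat (μ : SignedMeasure R2) (t : ℝ) (x : R2) : ℝ :=
  ∫ s in Set.Ioo (0:ℝ) t, ∫ y : R2,
    heatKernel (t - s) (x - y) *
      fderiv ℝ (heatExt μ s) y (biotSavart (heatExt μ s) y)

lemma norm_perp (x : R2) : ‖perp x‖ = ‖x‖ := by
  simp [perp, EuclideanSpace.norm_eq, Fin.sum_univ_two, add_comm]

lemma perp_sub (x y : R2) : perp (x - y) = perp x - perp y := by
  ext i
  fin_cases i <;> simp [perp]; ring

lemma inner_perp_right (x y : R2) : inner ℝ x (perp y) = -inner ℝ (perp x) y := by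
  simp [perp, PiLp.inner_apply, Fin.sum_univ_two]

lemma continuous_perp : Continuous perp := by
  unfold perp
  simp only [WithLp.equiv_symm_apply]
  refine (PiLp.continuous_toLp 2 _).comp ?_
  refine continuous_pi fun i => ?_
  fin_cases i <;> simp <;> fun_prop

lemma heatKernel_nonneg {s : ℝ} (hs : 0 < s) (x : R2) : 0 ≤ heatKernel s x := by
  unfold heatKernel; positivity

lemma continuous_heatKernel (s : ℝ) : Continuous (heatKernel s) := by
  unfold heatKernel; fun_prop

lemma heatKernel_le {s : ℝ} (hs : 0 < s) (x : R2) : heatKernel s x ≤ (4 * π * s)⁻¹ := by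
  unfold heatKernel
  refine mul_le_of_le_one_right (by positivity) (Real.exp_le_one_iff.2 ?_)
  rw [neg_div]
  exact neg_nonpos.2 (by positivity)

lemma integral_exp_neg_mul_norm_sq {b : ℝ} (hb : 0 < b) :
    ∫ v : R2, Real.exp (-b * ‖v‖ ^ 2) = π / b := by
  rw [GaussianFourier.integral_rexp_neg_mul_sq_norm hb]
  simp

lemma integrable_exp_neg_mul_norm_sq {b : ℝ} (hb : 0 < b) :
    Integrable fun v : R2 => Real.exp (-b * ‖v‖ ^ 2) := by
  by_contra h
  have h1 := integral_exp_neg_mul_norm_sq hb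
  rw [integral_undef h] at h1
  have : 0 < π / b := by positivity
  linarith

lemma heatKernel_eq (s : ℝ) (x : R2) :
    heatKernel s x = (4 * π * s)⁻¹ * Real.exp (-(4 * s)⁻¹ * ‖x‖ ^ 2) := by
  unfold heatKernel
  congr 2
  ring

lemma integrable_heatKernel {s : ℝ} (hs : 0 < s) : Integrable (heatKernel s) := by
  simp_rw [funext (heatKernel_eq s)]
  exact (integrable_exp_neg_mul_norm_sq (by positivity)).const_mul _

lemma integral_heatKernel {s : ℝ} (hs : 0 < s) : ∫ x, heatKernel s x = 1 := by
  simp_rw [heatKernel_eq s]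
  rw [integral_const_mul, integral_exp_neg_mul_norm_sq (by positivity)]
  field_simp

/-- The function `‖x‖⁻¹` cut off to the ball of radius `r`. -/
def truncInv (r : ℝ) (x : R2) : ℝ := (Set.Iio r).indicator (fun ρ => ρ⁻¹) ‖x‖

lemma truncInv_nonneg (r : ℝ) (x : R2) : 0 ≤ truncInv r x :=
  Set.indicator_apply_nonneg fun _ => inv_nonneg.2 (norm_nonneg x)

lemma setIntegral_indicator_Iio_one {r : ℝ} (hr : 0 < r) :
    ∫ y in Set.Ioi (0 : ℝ), (Set.Iio r).indicator (fun _ => (1 : ℝ)) y = r := by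
  rw [setIntegral_indicator measurableSet_Iio, Set.Ioi_inter_Iio]
  simp [hr.le]

lemma integral_truncInv {r : ℝ} (hr : 0 < r) : ∫ x, truncInv r x = 2 * π * r := by
  have h := integral_fun_norm_addHaar (volume : Measure R2) ((Set.Iio r).indicator (fun ρ => ρ⁻¹))
  have h2 : ∫ y in Set.Ioi (0 : ℝ), y ^ (Module.finrank ℝ R2 - 1) •
      (Set.Iio r).indicator (fun ρ : ℝ => ρ⁻¹) y = r := by
    refine Eq.trans ?_ (setIntegral_indicator_Iio_one hr)
    refine setIntegral_congr_fun measurableSet_Ioi fun y hy => ?_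
    have hy : y ≠ 0 := ne_of_gt hy
    by_cases h : y < r <;> simp [h, hy]
  rw [h2] at h
  unfold truncInv
  rw [h]
  simp [Measure.real, EuclideanSpace.volume_ball_fin_two, pi_nonneg]
  ring

lemma integrable_truncInv {r : ℝ} (hr : 0 < r) : Integrable (truncInv r) := by
  by_contra h
  have h1 := integral_truncInv hr
  rw [integral_undef h] at h1
  have : 0 < 2 * π * r := by positivity
  linarith

lemma heatKernel_div_norm_le {s : ℝ} (hs : 0 < s) (z y : R2) :
    heatKernel s y / ‖z - y‖ ≤
      (4 * π * s)⁻¹ * truncInv (√s) (z - y) + heatKernel s y * (√s)⁻¹ := by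
  have h0 := heatKernel_nonneg hs y
  by_cases h : ‖z - y‖ < √s
  · have : truncInv (√s) (z - y) = ‖z - y‖⁻¹ := by simp [truncInv, h]
    rw [this, div_eq_mul_inv]
    have := mul_le_mul_of_nonneg_right (heatKernel_le hs y) (inv_nonneg.2 (norm_nonneg (z - y)))
    have : 0 ≤ heatKernel s y * (√s)⁻¹ := by positivity
    linarith
  · have : truncInv (√s) (z - y) = 0 := by simp [truncInv, h]
    rw [this, div_eq_mul_inv]
    have h1 : ‖z - y‖⁻¹ ≤ (√s)⁻¹ := inv_anti₀ (by positivity) (not_lt.1 h)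
    have := mul_le_mul_of_nonneg_left h1 h0
    linarith

lemma integrable_heatKernel_div_norm {s : ℝ} (hs : 0 < s) (z : R2) :
    Integrable fun y => heatKernel s y / ‖z - y‖ := by
  refine Integrable.mono' ((((integrable_truncInv (sqrt_pos.2 hs)).comp_sub_left z).const_mul
    (4 * π * s)⁻¹).add ((integrable_heatKernel hs).mul_const (√s)⁻¹)) ?_ (.of_forall fun y => ?_)
  · exact ((continuous_heatKernel s).measurable.div (by fun_prop)).aestronglyMeasurable
  · rw [norm_of_nonneg (div_nonneg (heatKernel_nonneg hs y) (norm_nonneg _))]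
    exact heatKernel_div_norm_le hs z y

lemma integral_heatKernel_div_norm_le {s : ℝ} (hs : 0 < s) (z : R2) :
    ∫ y, heatKernel s y / ‖z - y‖ ≤ 3 / 2 * (√s)⁻¹ := by
  have i1 := ((integrable_truncInv (sqrt_pos.2 hs)).comp_sub_left z).const_mul (4 * π * s)⁻¹
  have i2 := (integrable_heatKernel hs).mul_const (√s)⁻¹
  refine (integral_mono (integrable_heatKernel_div_norm hs z) (i1.add i2)
    (heatKernel_div_norm_le hs z)).trans ?_
  simp only [Pi.add_apply]
  rw [integral_add i1 i2, integral_const_mul, integral_mul_const, integral_heatKernel hs,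
    integral_sub_left_eq_self (truncInv (√s)), integral_truncInv (sqrt_pos.2 hs)]
  have h : (4 * π * s)⁻¹ * (2 * π * √s) = 1 / 2 * (√s)⁻¹ := by
    nth_rw 1 [← Real.mul_self_sqrt hs.le]
    field_simp
    norm_num
  rw [h]
  linarith

/-- The integrand of the Biot–Savart velocity of `ω` at `z`. -/
def bsIntegrand (ω : R2 → ℝ) (z y : R2) : R2 := (ω y / ‖z - y‖ ^ 2) • perp (z - y)

lemma norm_bsIntegrand {s : ℝ} (hs : 0 < s) (z y : R2) :
    ‖bsIntegrand (heatKernel s) z y‖ = heatKernel s y / ‖z - y‖ := by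
  unfold bsIntegrand
  rw [norm_smul, norm_perp, norm_div, norm_of_nonneg (heatKernel_nonneg hs y), norm_pow, norm_norm]
  rcases eq_or_ne ‖z - y‖ 0 with h | h
  · simp [h]
  · field_simp

lemma measurable_bsIntegrand {ω : R2 → ℝ} (hω : Measurable ω) :
    Measurable (Function.uncurry (bsIntegrand ω)) := by
  unfold bsIntegrand Function.uncurry
  have h1 : Measurable fun q : R2 × R2 => ω q.2 / ‖q.1 - q.2‖ ^ 2 :=
    (hω.comp measurable_snd).div (by fun_prop)
  exact h1.smul (continuous_perp.measurable.comp (measurable_fst.sub measurable_snd))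

lemma integrable_bsIntegrand {s : ℝ} (hs : 0 < s) (z : R2) :
    Integrable (bsIntegrand (heatKernel s) z) := by
  rw [← integrable_norm_iff]
  · simpa only [norm_bsIntegrand hs] using integrable_heatKernel_div_norm hs z
  · exact ((measurable_bsIntegrand (continuous_heatKernel s).measurable).comp
      measurable_prodMk_left).aestronglyMeasurable

lemma biotSavart_eq (ω : R2 → ℝ) (z : R2) :
    biotSavart ω z = (2 * π)⁻¹ • ∫ y, bsIntegrand ω z y := rfl

lemma norm_biotSavart_heatKernel_le_integral {s : ℝ} (hs : 0 < s) (z : R2) :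
    ‖biotSavart (heatKernel s) z‖ ≤ (2 * π)⁻¹ * ∫ y, heatKernel s y / ‖z - y‖ := by
  rw [biotSavart_eq, norm_smul, norm_of_nonneg (by positivity)]
  refine mul_le_mul_of_nonneg_left ?_ (by positivity)
  simp_rw [← norm_bsIntegrand hs]
  exact norm_integral_le_integral_norm _

lemma two_pi_inv_le : (2 * π)⁻¹ ≤ 1 / 6 := by
  rw [one_div]
  exact inv_anti₀ (by norm_num) (by linarith [pi_gt_three])

lemma norm_biotSavart_heatKernel_le {s : ℝ} (hs : 0 < s) (z : R2) :
    ‖biotSavart (heatKernel s) z‖ ≤ (√s)⁻¹ := by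
  refine (norm_biotSavart_heatKernel_le_integral hs z).trans ?_
  have h := integral_heatKernel_div_norm_le hs z
  have h1 : 0 ≤ (√s)⁻¹ := by positivity
  have := mul_le_mul two_pi_inv_le h (integral_nonneg fun y =>
    div_nonneg (heatKernel_nonneg hs y) (norm_nonneg _)) (by norm_num)
  linarith

/-- Polynomial factors are absorbed by doubling the time of the heat kernel. -/
lemma sq_mul_heatKernel_le {s : ℝ} (hs : 0 < s) (x : R2) :
    (1 + ‖x‖ ^ 2 / (8 * s)) * heatKernel s x ≤ 2 * heatKernel (2 * s) x := by
  have h := add_one_le_exp (‖x‖ ^ 2 / (8 * s))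
  unfold heatKernel
  have e1 : Real.exp (-‖x‖ ^ 2 / (4 * (2 * s))) =
      Real.exp (‖x‖ ^ 2 / (8 * s)) * Real.exp (-‖x‖ ^ 2 / (4 * s)) := by
    rw [← Real.exp_add]
    congr 1
    ring
  rw [e1]
  have e2 : 2 * ((4 * π * (2 * s))⁻¹ *
      (Real.exp (‖x‖ ^ 2 / (8 * s)) * Real.exp (-‖x‖ ^ 2 / (4 * s)))) =
      Real.exp (‖x‖ ^ 2 / (8 * s)) * ((4 * π * s)⁻¹ * Real.exp (-‖x‖ ^ 2 / (4 * s))) := by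
    field_simp
  rw [e2]
  refine mul_le_mul_of_nonneg_right (by linarith) (by positivity)

lemma norm_mul_heatKernel_le {s : ℝ} (hs : 0 < s) (x : R2) :
    ‖x‖ * heatKernel s x ≤ 4 * √s * heatKernel (2 * s) x := by
  have h := sq_mul_heatKernel_le hs x
  have h0 := heatKernel_nonneg hs x
  have hq : ‖x‖ ≤ 2 * √s * (1 + ‖x‖ ^ 2 / (8 * s)) := by
    have : 2 * √s * (1 + ‖x‖ ^ 2 / (8 * s)) - ‖x‖ = (√s)⁻¹ * ((‖x‖ / 2 - √s) ^ 2 + √s ^ 2) := by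
      have : s = √s * √s := (Real.mul_self_sqrt hs.le).symm
      have hp := sqrt_pos.2 hs
      nth_rw 2 [this]
      field_simp
      ring
    have : 0 ≤ (√s)⁻¹ * ((‖x‖ / 2 - √s) ^ 2 + √s ^ 2) := by positivity
    linarith
  calc ‖x‖ * heatKernel s x ≤ 2 * √s * (1 + ‖x‖ ^ 2 / (8 * s)) * heatKernel s x :=
        mul_le_mul_of_nonneg_right hq h0
    _ = 2 * √s * ((1 + ‖x‖ ^ 2 / (8 * s)) * heatKernel s x) := by ring
    _ ≤ 2 * √s * (2 * heatKernel (2 * s) x) := mul_le_mul_of_nonneg_left h (by positivity)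
    _ = _ := by ring

lemma norm_mul_norm_biotSavart_heatKernel_le {s : ℝ} (hs : 0 < s) (z : R2) :
    ‖z‖ * ‖biotSavart (heatKernel s) z‖ ≤ 2 := by
  have h2s : 0 < 2 * s := by positivity
  have key (y : R2) : ‖z‖ * (heatKernel s y / ‖z - y‖) ≤
      heatKernel s y + 4 * √s * (heatKernel (2 * s) y / ‖z - y‖) := by
    have h0 := heatKernel_nonneg hs y
    have h1 : ‖z‖ ≤ ‖z - y‖ + ‖y‖ := by simpa using norm_add_le (z - y) y
    have h2 := norm_mul_heatKernel_le hs y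
    have h3 : ‖z - y‖ * (heatKernel s y / ‖z - y‖) ≤ heatKernel s y := by
      rcases eq_or_ne ‖z - y‖ 0 with h | h
      · simpa [h] using h0
      · field_simp; rfl
    have h4 : 0 ≤ heatKernel s y / ‖z - y‖ := by positivity
    have h5 : ‖y‖ * (heatKernel s y / ‖z - y‖) ≤
        4 * √s * (heatKernel (2 * s) y / ‖z - y‖) := by
      rw [← mul_div_assoc, ← mul_div_assoc]
      gcongr
    nlinarith
  have hint : ‖z‖ * ∫ y, heatKernel s y / ‖z - y‖ ≤ 7 := by
    rw [← integral_const_mul]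
    have i2 := (integrable_heatKernel_div_norm h2s z).const_mul (4 * √s)
    refine (integral_mono ((integrable_heatKernel_div_norm hs z).const_mul _)
      ((integrable_heatKernel hs).add i2) key).trans ?_
    simp only [Pi.add_apply]
    rw [integral_add (integrable_heatKernel hs) i2, integral_heatKernel hs, integral_const_mul]
    have h := integral_heatKernel_div_norm_le h2s z
    have h' : √s * (√(2 * s))⁻¹ ≤ 1 := by
      rw [← div_eq_mul_inv]
      exact div_le_one_of_le₀ (sqrt_le_sqrt (by linarith)) (by positivity)
    have := mul_le_mul_of_nonneg_left h (by positivity : 0 ≤ 4 * √s)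
    nlinarith
  calc ‖z‖ * ‖biotSavart (heatKernel s) z‖
      ≤ ‖z‖ * ((2 * π)⁻¹ * ∫ y, heatKernel s y / ‖z - y‖) :=
        mul_le_mul_of_nonneg_left (norm_biotSavart_heatKernel_le_integral hs z) (norm_nonneg _)
    _ = (2 * π)⁻¹ * (‖z‖ * ∫ y, heatKernel s y / ‖z - y‖) := by ring
    _ ≤ 1 / 6 * 7 := mul_le_mul two_pi_inv_le hint (mul_nonneg (norm_nonneg _)
        (integral_nonneg fun y => div_nonneg (heatKernel_nonneg hs y) (norm_nonneg _)))
        (by norm_num)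
    _ ≤ 2 := by norm_num

/-- A radial vorticity induces a velocity orthogonal to the position vector. -/
lemma inner_biotSavart_heatKernel {s : ℝ} (hs : 0 < s) (z : R2) :
    inner ℝ z (biotSavart (heatKernel s) z) = 0 := by
  set R : R2 ≃ₗᵢ[ℝ] R2 := (Submodule.span ℝ {z}).reflection with hR
  have hz : R z = z :=
    Submodule.reflection_mem_subspace_eq_self (Submodule.mem_span_singleton_self z)
  have hpz : R (perp z) = -perp z := by
    refine Submodule.reflection_mem_subspace_orthogonalComplement_eq_neg ?_
    rw [Submodule.mem_orthogonal_singleton_iff_inner_right]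
    simp [perp, PiLp.inner_apply, Fin.sum_univ_two]
    ring
  have hsym (w : R2) : inner ℝ z (perp (R w)) = -inner ℝ z (perp w) := by
    rw [inner_perp_right, inner_perp_right z w, ← R.inner_map_map (perp z) w, hpz]
    simp
  have hint : ∫ y, inner ℝ z (bsIntegrand (heatKernel s) z y) =
      -∫ y, inner ℝ z (bsIntegrand (heatKernel s) z y) := by
    nth_rw 1 [← R.measurePreserving.integral_comp R.toHomeomorph.measurableEmbedding]
    rw [← integral_neg]
    refine integral_congr_ae (.of_forall fun y => ?_)
    have e : z - R y = R (z - y) := by rw [map_sub, hz]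
    have hk : heatKernel s (R y) = heatKernel s y := by simp [heatKernel]
    simp only [bsIntegrand, inner_smul_right, e, R.norm_map, hk, hsym]
    ring
  rw [biotSavart_eq, inner_smul_right, ← integral_inner (integrable_bsIntegrand hs z)]
  rw [show ∫ y, inner ℝ z (bsIntegrand (heatKernel s) z y) = 0 by linarith, mul_zero]

lemma heatKernel_le_two_mul {s : ℝ} (hs : 0 < s) (x : R2) :
    heatKernel s x ≤ 2 * heatKernel (2 * s) x := by
  have h := sq_mul_heatKernel_le hs x
  have : 0 ≤ ‖x‖ ^ 2 / (8 * s) * heatKernel s x :=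
    mul_nonneg (by positivity) (heatKernel_nonneg hs x)
  linarith

/-- The differential of the heat kernel. -/
def heatKernelFDeriv (s : ℝ) (z : R2) : R2 →L[ℝ] ℝ := (-(heatKernel s z / (2 * s))) • innerSL ℝ z

lemma hasFDerivAt_heatKernel (s : ℝ) (z : R2) :
    HasFDerivAt (heatKernel s) (heatKernelFDeriv s z) z := by
  have h1 : HasFDerivAt (fun x : R2 => -(4 * s)⁻¹ * ‖x‖ ^ 2) (-(4 * s)⁻¹ • (2 • innerSL ℝ z)) z :=
    (hasStrictFDerivAt_norm_sq z).hasFDerivAt.const_mul _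
  have h2 := (h1.exp).const_mul (4 * π * s)⁻¹
  rw [← funext (heatKernel_eq s)] at h2
  refine h2.congr_fderiv ?_
  ext v
  simp only [heatKernelFDeriv, heatKernel_eq, _root_.smul_apply, smul_eq_mul,
    innerSL_apply_apply, nsmul_eq_mul]
  simp
  ring

lemma continuous_heatKernelFDeriv (s : ℝ) : Continuous (heatKernelFDeriv s) := by
  unfold heatKernelFDeriv
  exact (((continuous_heatKernel s).div_const _).neg).smul (innerSL ℝ).continuous

lemma norm_heatKernelFDeriv_le {s : ℝ} (hs : 0 < s) (z : R2) :
    ‖heatKernelFDeriv s z‖ ≤ 4 * √s * (4 * π * (2 * s))⁻¹ / (2 * s) := by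
  have h0 := heatKernel_nonneg hs z
  rw [heatKernelFDeriv, norm_smul, innerSL_apply_norm, norm_neg, norm_of_nonneg (by positivity)]
  rw [div_mul_eq_mul_div, mul_comm]
  refine div_le_div_of_nonneg_right ?_ (by positivity)
  exact (norm_mul_heatKernel_le hs z).trans
    (mul_le_mul_of_nonneg_left (heatKernel_le (by positivity) z) (by positivity))

/-- Heat extension of a positive measure. -/
def heatExtPos (ρ : Measure R2) (s : ℝ) (y : R2) : ℝ := ∫ a, heatKernel s (y - a) ∂ρ

lemma bsIntegrand_heatExtPos (ρ : Measure R2) (s : ℝ) (x y : R2) :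
    bsIntegrand (heatExtPos ρ s) x y = ∫ a, bsIntegrand (heatKernel s) (x - a) (y - a) ∂ρ := by
  simp only [bsIntegrand, heatExtPos, sub_sub_sub_cancel_right]
  rw [integral_smul_const, integral_div]

section FiniteMeasure

variable (ρ : Measure R2) [IsFiniteMeasure ρ]

lemma integrable_heatKernel_sub {s : ℝ} (hs : 0 < s) (y : R2) :
    Integrable (fun a => heatKernel s (y - a)) ρ := by
  refine Integrable.of_bound ((continuous_heatKernel s).comp
    (by fun_prop : Continuous fun a => y - a)).aestronglyMeasurable (4 * π * s)⁻¹
    (.of_forall fun a => ?_)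
  rw [norm_of_nonneg (heatKernel_nonneg hs _)]
  exact heatKernel_le hs _

lemma integrable_heatKernelFDeriv_sub {s : ℝ} (hs : 0 < s) (y : R2) :
    Integrable (fun b => heatKernelFDeriv s (y - b)) ρ :=
  Integrable.of_bound ((continuous_heatKernelFDeriv s).comp
    (by fun_prop : Continuous fun a => y - a)).aestronglyMeasurable _
    (.of_forall fun b => norm_heatKernelFDeriv_le hs (y - b))

lemma hasFDerivAt_heatExtPos {s : ℝ} (hs : 0 < s) (y : R2) :
    HasFDerivAt (heatExtPos ρ s) (∫ b, heatKernelFDeriv s (y - b) ∂ρ) y := by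
  refine hasFDerivAt_integral_of_dominated_of_fderiv_le (s := Set.univ) (μ := ρ)
    (bound := fun _ => 4 * √s * (4 * π * (2 * s))⁻¹ / (2 * s))
    (F' := fun x b => heatKernelFDeriv s (x - b)) univ_mem
    (.of_forall fun x => (integrable_heatKernel_sub ρ hs x).aestronglyMeasurable)
    (integrable_heatKernel_sub ρ hs y)
    (integrable_heatKernelFDeriv_sub ρ hs y).aestronglyMeasurable
    (.of_forall fun b x _ => norm_heatKernelFDeriv_le hs (x - b)) (integrable_const _)
    (.of_forall fun b x _ => ?_)
  exact (hasFDerivAt_heatKernel s (x - b)).comp x ((hasFDerivAt_id x).sub_const b)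

lemma integrable_prod_bsIntegrand {s : ℝ} (hs : 0 < s) (x : R2) :
    Integrable (fun q : R2 × R2 => bsIntegrand (heatKernel s) (x - q.2) (q.1 - q.2))
      (volume.prod ρ) := by
  have hm : AEStronglyMeasurable
      (fun q : R2 × R2 => bsIntegrand (heatKernel s) (x - q.2) (q.1 - q.2)) (volume.prod ρ) :=
    ((measurable_bsIntegrand (continuous_heatKernel s).measurable).comp
      (by fun_prop : Measurable fun q : R2 × R2 => (x - q.2, q.1 - q.2))).aestronglyMeasurable
  rw [integrable_prod_iff' hm]
  refine ⟨.of_forall fun a => (integrable_bsIntegrand hs (x - a)).comp_sub_right a, ?_⟩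
  refine Integrable.of_bound hm.norm.prod_swap.integral_prod_right' (3 / 2 * (√s)⁻¹)
    (.of_forall fun a => ?_)
  rw [norm_of_nonneg (integral_nonneg fun _ => norm_nonneg _)]
  simp_rw [norm_bsIntegrand hs]
  rw [integral_sub_right_eq_self (fun y => heatKernel s y / ‖x - a - y‖)]
  exact integral_heatKernel_div_norm_le hs (x - a)

lemma integrable_bsIntegrand_heatExtPos {s : ℝ} (hs : 0 < s) (x : R2) :
    Integrable (bsIntegrand (heatExtPos ρ s) x) := by
  simp_rw [funext (bsIntegrand_heatExtPos ρ s x)]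
  exact (integrable_prod_bsIntegrand ρ hs x).integral_prod_left

lemma biotSavart_sub_eq_integral (s : ℝ) (x a : R2) : biotSavart (heatKernel s) (x - a) =
    (2 * π)⁻¹ • ∫ y, bsIntegrand (heatKernel s) (x - a) (y - a) := by
  rw [biotSavart_eq, integral_sub_right_eq_self (bsIntegrand (heatKernel s) (x - a))]

lemma integrable_biotSavart_sub {s : ℝ} (hs : 0 < s) (x : R2) :
    Integrable (fun a => biotSavart (heatKernel s) (x - a)) ρ := by
  simp_rw [biotSavart_sub_eq_integral]
  exact (integrable_prod_bsIntegrand ρ hs x).integral_prod_right.smul (2 * π)⁻¹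

lemma biotSavart_heatExtPos {s : ℝ} (hs : 0 < s) (x : R2) :
    biotSavart (heatExtPos ρ s) x = ∫ a, biotSavart (heatKernel s) (x - a) ∂ρ := by
  simp_rw [biotSavart_sub_eq_integral]
  rw [biotSavart_eq, integral_smul]
  simp_rw [bsIntegrand_heatExtPos]
  rw [integral_integral_swap (integrable_prod_bsIntegrand ρ hs x)]

lemma enorm_integral_heatKernelFDeriv_integral_biotSavart_le (σ : Measure R2) [IsFiniteMeasure σ]
    {s : ℝ} (hs : 0 < s) (y : R2) :
    ‖(∫ b, heatKernelFDeriv s (y - b) ∂σ) (∫ a, biotSavart (heatKernel s) (y - a) ∂ρ)‖ₑ ≤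
      ∫⁻ b, ∫⁻ a, ‖heatKernelFDeriv s (y - b) (biotSavart (heatKernel s) (y - a))‖ₑ ∂ρ ∂σ := by
  rw [ContinuousLinearMap.integral_apply (integrable_heatKernelFDeriv_sub σ hs y)]
  refine (enorm_integral_le_lintegral_enorm _).trans (lintegral_mono fun b => ?_)
  rw [← ContinuousLinearMap.integral_comp_comm _ (integrable_biotSavart_sub ρ hs y)]
  exact enorm_integral_le_lintegral_enorm _

end FiniteMeasure

lemma abs_heatKernelFDeriv_biotSavart_le {s : ℝ} (hs : 0 < s) (w z : R2) :
    |heatKernelFDeriv s w (biotSavart (heatKernel s) z)| ≤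
      16 * (‖z - w‖ / (√s * (s + ‖z - w‖ ^ 2))) * heatKernel (2 * s) w := by
  set V := biotSavart (heatKernel s) z with hV
  set d := ‖z - w‖
  set r := ‖w‖
  have hσ := sqrt_pos.2 hs
  have hs2 : s = √s ^ 2 := (Real.sq_sqrt hs.le).symm
  have hk := heatKernel_nonneg hs w
  have hd : 0 ≤ d := norm_nonneg _
  have hr : 0 ≤ r := norm_nonneg _
  have h1 : ‖V‖ ≤ (√s)⁻¹ := norm_biotSavart_heatKernel_le hs z
  have h2 : ‖z‖ * ‖V‖ ≤ 2 := norm_mul_norm_biotSavart_heatKernel_le hs z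
  have h3 : inner ℝ z V = 0 := inner_biotSavart_heatKernel hs z
  have e1 : |inner ℝ w V| ≤ d * ‖V‖ := by
    have : inner ℝ w V = -inner ℝ (z - w) V := by rw [inner_sub_left, h3]; ring
    rw [this, abs_neg]
    exact abs_real_inner_le_norm _ _
  have e2 : |inner ℝ w V| ≤ r * ‖V‖ := abs_real_inner_le_norm _ _
  have e3 : d * ‖V‖ ≤ 2 + r * (√s)⁻¹ := by
    have : d ≤ ‖z‖ + r := norm_sub_le _ _
    nlinarith [norm_nonneg V]
  have hD : |heatKernelFDeriv s w V| = heatKernel s w / (2 * s) * |inner ℝ w V| := by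
    simp only [heatKernelFDeriv, _root_.smul_apply, smul_eq_mul, innerSL_apply_apply]
    rw [abs_mul, abs_neg, abs_of_nonneg (by positivity)]
  have b1 : s * |inner ℝ w V| ≤ s * (d * (√s)⁻¹) := by
    gcongr
    exact e1.trans (by gcongr)
  have b2 : d ^ 2 * |inner ℝ w V| ≤ d * r * (2 + r * (√s)⁻¹) := by
    calc d ^ 2 * |inner ℝ w V| ≤ d ^ 2 * (r * ‖V‖) := by gcongr
      _ = d * r * (d * ‖V‖) := by ring
      _ ≤ _ := by gcongr
  have b3 : (s + d ^ 2) * |inner ℝ w V| ≤ 2 * s * (8 * (d / √s) * (1 + r ^ 2 / (8 * s))) := by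
    have e : 2 * s * (8 * (d / √s) * (1 + r ^ 2 / (8 * s))) -
        (s * (d * (√s)⁻¹) + d * r * (2 + r * (√s)⁻¹)) =
        d * (√s)⁻¹ * ((r - √s) ^ 2 + 14 * √s ^ 2) := by
      rw [hs2, Real.sqrt_sq hσ.le]
      field_simp
      ring
    have : 0 ≤ d * (√s)⁻¹ * ((r - √s) ^ 2 + 14 * √s ^ 2) := by positivity
    linarith
  have hpos : 0 < s + d ^ 2 := by positivity
  have h4 : 8 * (d / √s) * ((1 + r ^ 2 / (8 * s)) * heatKernel s w) ≤
      8 * (d / √s) * (2 * heatKernel (2 * s) w) :=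
    mul_le_mul_of_nonneg_left (sq_mul_heatKernel_le hs w) (by positivity)
  rw [hD]
  have h5 : (s + d ^ 2) * (heatKernel s w / (2 * s) * |inner ℝ w V|) ≤
      8 * (d / √s) * (2 * heatKernel (2 * s) w) := by
    refine le_trans ?_ h4
    calc (s + d ^ 2) * (heatKernel s w / (2 * s) * |inner ℝ w V|)
        = heatKernel s w / (2 * s) * ((s + d ^ 2) * |inner ℝ w V|) := by ring
      _ ≤ heatKernel s w / (2 * s) * (2 * s * (8 * (d / √s) * (1 + r ^ 2 / (8 * s)))) := by gcongr
      _ = _ := by field_simp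
  have h6 : 16 * (d / (√s * (s + d ^ 2))) * heatKernel (2 * s) w =
      8 * (d / √s) * (2 * heatKernel (2 * s) w) / (s + d ^ 2) := by
    field_simp
    ring
  rw [h6, le_div_iff₀ hpos]
  linarith

lemma heatKernel_mul_heatKernel {α β : ℝ} (hα : 0 < α) (hβ : 0 < β) (x y b : R2) :
    heatKernel α (x - y) * heatKernel β (y - b) =
      heatKernel (α + β) (x - b) *
        heatKernel (α * β / (α + β)) (y - (α + β)⁻¹ • (β • x + α • b)) := by
  have hαβ : 0 < α + β := by positivity
  unfold heatKernel
  rw [mul_mul_mul_comm, mul_mul_mul_comm (4 * π * (α + β))⁻¹, ← Real.exp_add, ← Real.exp_add]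
  congr 1
  · field_simp
  · congr 1
    simp only [EuclideanSpace.norm_sq_eq, Fin.sum_univ_two, Real.norm_eq_abs, sq_abs,
      PiLp.sub_apply, PiLp.add_apply, PiLp.smul_apply, smul_eq_mul]
    field_simp
    ring

lemma lintegral_heatKernel_sub {s : ℝ} (hs : 0 < s) (b : R2) :
    ∫⁻ y, ENNReal.ofReal (heatKernel s (y - b)) = 1 := by
  rw [← ofReal_integral_eq_lintegral_ofReal ((integrable_heatKernel hs).comp_sub_right b)
    (.of_forall fun y => heatKernel_nonneg hs _), integral_sub_right_eq_self (heatKernel s),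
    integral_heatKernel hs, ENNReal.ofReal_one]

lemma lintegral_heatKernel_mul_heatKernel {α β : ℝ} (hα : 0 < α) (hβ : 0 < β) (x b : R2) :
    ∫⁻ y, ENNReal.ofReal (heatKernel α (x - y) * heatKernel β (y - b)) =
      ENNReal.ofReal (heatKernel (α + β) (x - b)) := by
  have hαβ : 0 < α + β := by positivity
  simp_rw [heatKernel_mul_heatKernel hα hβ, ENNReal.ofReal_mul (heatKernel_nonneg hαβ _)]
  rw [lintegral_const_mul' _ _ ENNReal.ofReal_ne_top, lintegral_heatKernel_sub (by positivity),
    mul_one]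

lemma lintegral_Ioo_div_sqrt_mul_le {t : ℝ} (ht : 0 < t) {d : ℝ} (hd : 0 ≤ d) :
    ∫⁻ s in Set.Ioo (0 : ℝ) t, ENNReal.ofReal (d / (√s * (s + d ^ 2))) ≤
      ENNReal.ofReal (2 * arctan (√t / d)) := by
  rcases hd.eq_or_lt with rfl | hd
  · simp
  have hcont : ContinuousOn (fun s => 2 * arctan (√s / d)) (Set.Icc 0 t) := by fun_prop
  have hderiv : ∀ s ∈ Set.Ioo 0 t,
      HasDerivAt (fun s => 2 * arctan (√s / d)) (d / (√s * (s + d ^ 2))) s := by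
    intro s hs
    have hs0 : 0 < s := hs.1
    have hσ := sqrt_pos.2 hs0
    have h := ((((hasDerivAt_id s).sqrt hs0.ne').div_const d).arctan).const_mul 2
    refine h.congr_deriv ?_
    simp only [id, div_pow, Real.sq_sqrt hs0.le]
    field_simp
    ring
  have hnn : ∀ s ∈ Set.Ioo 0 t, 0 ≤ d / (√s * (s + d ^ 2)) := by
    intro s hs
    have hs0 : 0 < s := hs.1
    positivity
  have hint := intervalIntegral.integrableOn_deriv_of_nonneg hcont hderiv hnn
  have hI := intervalIntegral.integral_eq_sub_of_hasDerivAt_of_le ht.le hcont hderiv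
    ((intervalIntegrable_iff_integrableOn_Ioc_of_le ht.le).2 hint)
  rw [intervalIntegral.integral_of_le ht.le] at hI
  rw [← ofReal_integral_eq_lintegral_ofReal (hint.mono_set Set.Ioo_subset_Ioc_self)
    ((ae_restrict_iff' measurableSet_Ioo).2 (.of_forall hnn))]
  rw [← integral_Ioc_eq_integral_Ioo, hI]
  simp

/-- The total variation measure, as the sum of the two parts of the Jordan decomposition. -/
def jordanSum (μ : SignedMeasure R2) : Measure R2 :=
  μ.toJordanDecomposition.posPart + μ.toJordanDecomposition.negPart

instance (μ : SignedMeasure R2) : IsFiniteMeasure (jordanSum μ) := by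
  unfold jordanSum; infer_instance

lemma heatExt_eq_sub (μ : SignedMeasure R2) (s : ℝ) :
    heatExt μ s = heatExtPos μ.toJordanDecomposition.posPart s -
      heatExtPos μ.toJordanDecomposition.negPart s := rfl

lemma fderiv_heatExt (μ : SignedMeasure R2) {s : ℝ} (hs : 0 < s) (y : R2) :
    fderiv ℝ (heatExt μ s) y =
      (∫ b, heatKernelFDeriv s (y - b) ∂μ.toJordanDecomposition.posPart) -
        ∫ b, heatKernelFDeriv s (y - b) ∂μ.toJordanDecomposition.negPart := by
  rw [heatExt_eq_sub]
  exact ((hasFDerivAt_heatExtPos _ hs y).sub (hasFDerivAt_heatExtPos _ hs y)).fderiv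

lemma biotSavart_heatExt (μ : SignedMeasure R2) {s : ℝ} (hs : 0 < s) (y : R2) :
    biotSavart (heatExt μ s) y =
      (∫ a, biotSavart (heatKernel s) (y - a) ∂μ.toJordanDecomposition.posPart) -
        ∫ a, biotSavart (heatKernel s) (y - a) ∂μ.toJordanDecomposition.negPart := by
  rw [← biotSavart_heatExtPos _ hs, ← biotSavart_heatExtPos _ hs, biotSavart_eq, biotSavart_eq,
    biotSavart_eq, ← smul_sub, ← integral_sub (integrable_bsIntegrand_heatExtPos _ hs y)
    (integrable_bsIntegrand_heatExtPos _ hs y), heatExt_eq_sub]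
  congr 2
  ext1 z
  simp only [bsIntegrand, Pi.sub_apply, sub_div, sub_smul]

lemma enorm_sub_apply_sub_le {E : Type*} [NormedAddCommGroup E] [NormedSpace ℝ E]
    (A B : E →L[ℝ] ℝ) (u v : E) :
    ‖(A - B) (u - v)‖ₑ ≤ (‖A u‖ₑ + ‖A v‖ₑ) + (‖B u‖ₑ + ‖B v‖ₑ) := by
  rw [_root_.sub_apply, map_sub, map_sub]
  exact enorm_sub_le.trans <| add_le_add enorm_sub_le enorm_sub_le

lemma enorm_transport_le (μ : SignedMeasure R2) {s : ℝ} (hs : 0 < s) (y : R2) :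
    ‖fderiv ℝ (heatExt μ s) y (biotSavart (heatExt μ s) y)‖ₑ ≤
      ∫⁻ q, ENNReal.ofReal (16 * (‖q.1 - q.2‖ / (√s * (s + ‖q.1 - q.2‖ ^ 2))) *
        heatKernel (2 * s) (y - q.2)) ∂(jordanSum μ).prod (jordanSum μ) := by
  have hbound : ‖fderiv ℝ (heatExt μ s) y (biotSavart (heatExt μ s) y)‖ₑ ≤
      ∫⁻ b, ∫⁻ a, ‖heatKernelFDeriv s (y - b) (biotSavart (heatKernel s) (y - a))‖ₑ
        ∂jordanSum μ ∂jordanSum μ := by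
    rw [fderiv_heatExt μ hs, biotSavart_heatExt μ hs]
    refine (enorm_sub_apply_sub_le _ _ _ _).trans ?_
    simp only [jordanSum, lintegral_add_measure]
    refine add_le_add ((add_le_add ?_ ?_).trans (le_lintegral_add _ _))
      ((add_le_add ?_ ?_).trans (le_lintegral_add _ _)) <;>
    exact enorm_integral_heatKernelFDeriv_integral_biotSavart_le _ _ hs y
  refine hbound.trans ?_
  have hm : Measurable fun q : R2 × R2 =>
      ENNReal.ofReal (16 * (‖q.1 - q.2‖ / (√s * (s + ‖q.1 - q.2‖ ^ 2))) *
        heatKernel (2 * s) (y - q.2)) := by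
    have := (continuous_heatKernel (2 * s)).measurable
    fun_prop
  rw [lintegral_prod_symm _ hm.aemeasurable]
  refine lintegral_mono fun b => lintegral_mono fun a => ?_
  rw [Real.enorm_eq_ofReal_abs]
  refine ENNReal.ofReal_le_ofReal ((abs_heatKernelFDeriv_biotSavart_le hs _ _).trans_eq ?_)
  simp only [sub_sub_sub_cancel_left, norm_sub_rev b a]

/-- The function dominating the Duhamel term. -/
def duhamelBound (μ : SignedMeasure R2) (t : ℝ) (x : R2) : ℝ≥0∞ :=
  ∫⁻ q, ENNReal.ofReal (64 * arctan (√t / ‖q.1 - q.2‖)) *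
    ENNReal.ofReal (heatKernel (2 * t) (x - q.2)) ∂(jordanSum μ).prod (jordanSum μ)

lemma lintegral_heatKernel_mul_transport_le (μ : SignedMeasure R2) {s t : ℝ} (hs : 0 < s)
    (hst : s < t) (x : R2) :
    ∫⁻ y, ‖heatKernel (t - s) (x - y) *
        fderiv ℝ (heatExt μ s) y (biotSavart (heatExt μ s) y)‖ₑ ≤
      ∫⁻ q, ENNReal.ofReal (‖q.1 - q.2‖ / (√s * (s + ‖q.1 - q.2‖ ^ 2))) *
        ENNReal.ofReal (32 * heatKernel (2 * t) (x - q.2))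
          ∂(jordanSum μ).prod (jordanSum μ) := by
  have hts : 0 < t - s := sub_pos.2 hst
  have hk (c : ℝ) : Measurable (heatKernel c) := (continuous_heatKernel c).measurable
  have step (y : R2) : ‖heatKernel (t - s) (x - y) *
        fderiv ℝ (heatExt μ s) y (biotSavart (heatExt μ s) y)‖ₑ ≤
      ∫⁻ q, ENNReal.ofReal (32 * (‖q.1 - q.2‖ / (√s * (s + ‖q.1 - q.2‖ ^ 2)))) *
        ENNReal.ofReal (heatKernel (2 * (t - s)) (x - y) * heatKernel (2 * s) (y - q.2))
          ∂(jordanSum μ).prod (jordanSum μ) := by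
    rw [enorm_mul, Real.enorm_of_nonneg (heatKernel_nonneg hts _)]
    refine (mul_le_mul_right (enorm_transport_le μ hs y) _).trans ?_
    rw [← lintegral_const_mul' _ _ ENNReal.ofReal_ne_top]
    refine lintegral_mono fun q => ?_
    rw [← ENNReal.ofReal_mul (heatKernel_nonneg hts _), ← ENNReal.ofReal_mul (by positivity)]
    refine ENNReal.ofReal_le_ofReal ?_
    have h1 := heatKernel_le_two_mul hts (x - y)
    have h2 := heatKernel_nonneg (by positivity : 0 < 2 * s) (y - q.2)
    calc _ ≤ 2 * heatKernel (2 * (t - s)) (x - y) *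
          (16 * (‖q.1 - q.2‖ / (√s * (s + ‖q.1 - q.2‖ ^ 2))) * heatKernel (2 * s) (y - q.2)) :=
          mul_le_mul_of_nonneg_right h1 (by positivity)
      _ = _ := by ring
  refine (lintegral_mono step).trans ?_
  rw [lintegral_lintegral_swap]
  · refine lintegral_mono fun q => ?_
    simp only
    rw [lintegral_const_mul' _ _ ENNReal.ofReal_ne_top,
      lintegral_heatKernel_mul_heatKernel (by positivity) (by positivity), ← mul_add,
      sub_add_cancel, ENNReal.ofReal_mul (by norm_num), ENNReal.ofReal_mul (by norm_num),
      ← mul_assoc, mul_comm (ENNReal.ofReal 32)]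
  · refine Measurable.aemeasurable ?_
    unfold Function.uncurry
    have := hk (2 * (t - s))
    have := hk (2 * s)
    fun_prop

lemma enorm_Fheat_le (μ : SignedMeasure R2) {t : ℝ} (ht : 0 < t) (x : R2) :
    ‖Fheat μ t x‖ₑ ≤ duhamelBound μ t x := by
  have step : ‖Fheat μ t x‖ₑ ≤ ∫⁻ s in Set.Ioo (0 : ℝ) t,
      ∫⁻ q, ENNReal.ofReal (‖q.1 - q.2‖ / (√s * (s + ‖q.1 - q.2‖ ^ 2))) *
        ENNReal.ofReal (32 * heatKernel (2 * t) (x - q.2))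
          ∂(jordanSum μ).prod (jordanSum μ) := by
    refine (enorm_integral_le_lintegral_enorm _).trans ?_
    refine setLIntegral_mono' measurableSet_Ioo fun s hs => ?_
    exact (enorm_integral_le_lintegral_enorm _).trans
      (lintegral_heatKernel_mul_transport_le μ hs.1 hs.2 x)
  refine step.trans ?_
  rw [lintegral_lintegral_swap]
  · refine lintegral_mono fun q => ?_
    simp only
    rw [lintegral_mul_const' _ _ ENNReal.ofReal_ne_top]
    refine (mul_le_mul_left (lintegral_Ioo_div_sqrt_mul_le ht (norm_nonneg _)) _).trans_eq ?_
    rw [ENNReal.ofReal_mul (by norm_num : (0 : ℝ) ≤ 2),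
      ENNReal.ofReal_mul (by norm_num : (0 : ℝ) ≤ 32),
      ENNReal.ofReal_mul (by norm_num : (0 : ℝ) ≤ 64),
      show (64 : ℝ) = 2 * 32 by norm_num, ENNReal.ofReal_mul (by norm_num : (0 : ℝ) ≤ 2)]
    ring
  · refine Measurable.aemeasurable ?_
    unfold Function.uncurry
    have := (continuous_heatKernel (2 * t)).measurable
    fun_prop

/-- The mass of the dominating function of the Duhamel term. -/
def interactionMass (μ : SignedMeasure R2) (t : ℝ) : ℝ≥0∞ :=
  ∫⁻ q, ENNReal.ofReal (64 * arctan (√t / ‖q.1 - q.2‖)) ∂(jordanSum μ).prod (jordanSum μ)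

lemma lintegral_duhamelBound (μ : SignedMeasure R2) {t : ℝ} (ht : 0 < t) :
    ∫⁻ x, duhamelBound μ t x = interactionMass μ t := by
  unfold duhamelBound interactionMass
  rw [lintegral_lintegral_swap]
  · refine lintegral_congr fun q => ?_
    rw [lintegral_const_mul' _ _ ENNReal.ofReal_ne_top, lintegral_heatKernel_sub (by positivity),
      mul_one]
  · refine Measurable.aemeasurable ?_
    unfold Function.uncurry
    have := (continuous_heatKernel (2 * t)).measurable
    fun_prop

lemma duhamelBound_le (μ : SignedMeasure R2) {t : ℝ} (ht : 0 < t) (x : R2) :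
    duhamelBound μ t x ≤ interactionMass μ t * ENNReal.ofReal t⁻¹ := by
  unfold duhamelBound interactionMass
  rw [← lintegral_mul_const' _ _ ENNReal.ofReal_ne_top]
  gcongr with q
  refine (heatKernel_le (by positivity) _).trans (inv_anti₀ ht ?_)
  nlinarith [pi_gt_three]

lemma tendsto_interactionMass (μ : SignedMeasure R2) :
    Tendsto (interactionMass μ) (𝓝[>] 0) (𝓝 0) := by
  have h := tendsto_lintegral_filter_of_dominated_convergence
    (μ := (jordanSum μ).prod (jordanSum μ)) (l := 𝓝[>] (0 : ℝ))
    (F := fun t q => ENNReal.ofReal (64 * arctan (√t / ‖q.1 - q.2‖)))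
    (f := fun _ => 0) (fun _ => ENNReal.ofReal (64 * (π / 2)))
    (.of_forall fun t => by fun_prop)
    (.of_forall fun t => .of_forall fun q =>
      ENNReal.ofReal_le_ofReal (by linarith [arctan_lt_pi_div_two (√t / ‖q.1 - q.2‖)]))
    (by simp [ENNReal.mul_eq_top, measure_ne_top])
    (.of_forall fun q => ?_)
  · rw [lintegral_zero] at h
    exact h
  · have hc : Continuous fun t : ℝ => ENNReal.ofReal (64 * arctan (√t / ‖q.1 - q.2‖)) :=
      ENNReal.continuous_ofReal.comp (by fun_prop)
    simpa using (hc.tendsto 0).mono_left nhdsWithin_le_nhds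

/-- Interpolation between `L¹` and `L^∞` bounds. -/
lemma ofReal_rpow_mul_eLpNorm_le {α : Type*} [MeasurableSpace α] {ν : Measure α} {f : α → ℝ}
    {g : α → ℝ≥0∞} {t : ℝ} (ht : 0 < t) {W : ℝ≥0∞} (hfg : ∀ x, ‖f x‖ₑ ≤ g x)
    (hg : ∫⁻ x, g x ∂ν ≤ W) (hgt : ∀ x, g x ≤ W * ENNReal.ofReal t⁻¹) {p : ℝ≥0∞} (hp : 1 ≤ p) :
    ENNReal.ofReal (t ^ (1 - 1 / p).toReal) * eLpNorm f p ν ≤ W := by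
  rcases eq_or_ne W ∞ with rfl | hW
  · exact le_top
  have hinv : ENNReal.ofReal t * ENNReal.ofReal t⁻¹ = 1 := by
    rw [← ENNReal.ofReal_mul ht.le, mul_inv_cancel₀ ht.ne', ENNReal.ofReal_one]
  rcases eq_or_ne p ∞ with rfl | hptop
  · have h : eLpNorm f ∞ ν ≤ W * ENNReal.ofReal t⁻¹ := by
      rw [eLpNorm_exponent_top]
      exact essSup_le_of_ae_le _ (.of_forall fun x => (hfg x).trans (hgt x))
    simp only [ENNReal.div_top, tsub_zero, ENNReal.toReal_one, rpow_one]
    refine (mul_le_mul_right h _).trans_eq ?_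
    rw [mul_left_comm, hinv, mul_one]
  · have hp0 : p ≠ 0 := (zero_lt_one.trans_le hp).ne'
    set r := p.toReal with hr
    have hr1 : 1 ≤ r := by simpa using ENNReal.toReal_mono hptop hp
    have hr0 : 0 < r := by linarith
    have hexp : (1 - 1 / p).toReal = (r - 1) * (1 / r) := by
      rw [ENNReal.toReal_sub_of_le (by simpa using hp) (by simp)]
      simp [← hr]
      field_simp
    have hint : ∫⁻ x, ‖f x‖ₑ ^ r ∂ν ≤ W ^ r * ENNReal.ofReal t⁻¹ ^ (r - 1) := by
      calc ∫⁻ x, ‖f x‖ₑ ^ r ∂ν ≤ ∫⁻ x, (W * ENNReal.ofReal t⁻¹) ^ (r - 1) * g x ∂ν := by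
            refine lintegral_mono fun x => ?_
            have e : r = (r - 1) + 1 := by ring
            nth_rw 1 [e]
            rw [ENNReal.rpow_add_of_nonneg _ _ (by linarith) zero_le_one, ENNReal.rpow_one]
            exact mul_le_mul' (ENNReal.rpow_le_rpow ((hfg x).trans (hgt x)) (by linarith)) (hfg x)
        _ ≤ (W * ENNReal.ofReal t⁻¹) ^ (r - 1) * W := by
            rw [lintegral_const_mul' _ _ (ENNReal.rpow_ne_top_of_nonneg (by linarith)
              (ENNReal.mul_ne_top hW ENNReal.ofReal_ne_top))]
            exact mul_le_mul_right hg _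
        _ = W ^ r * ENNReal.ofReal t⁻¹ ^ (r - 1) := by
            rw [ENNReal.mul_rpow_of_nonneg _ _ (by linarith), mul_right_comm]
            congr 1
            have e : r = (r - 1) + 1 := by ring
            nth_rw 2 [e]
            rw [ENNReal.rpow_add_of_nonneg _ _ (by linarith) zero_le_one, ENNReal.rpow_one]
    rw [eLpNorm_eq_lintegral_rpow_enorm_toReal hp0 hptop, hexp]
    refine (mul_le_mul_right (ENNReal.rpow_le_rpow hint (by positivity)) _).trans_eq ?_
    rw [ENNReal.mul_rpow_of_nonneg _ _ (by positivity), ← ENNReal.rpow_mul, ← ENNReal.rpow_mul,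
      mul_one_div_cancel hr0.ne', ENNReal.rpow_one, mul_left_comm,
      ← ENNReal.ofReal_rpow_of_pos ht, ← ENNReal.mul_rpow_of_nonneg _ _
        (mul_nonneg (by linarith) (by positivity)), hinv, ENNReal.one_rpow, mul_one]

/-- For every `p ∈ [1,∞]`,
`limsup_{t→0⁺} t^{1-1/p} ‖(Fω₀)(t)‖_{L^p} = 0`. -/
theorem selfInteraction_limsup_zero (μ : SignedMeasure R2) (p : ℝ≥0∞) (hp : 1 ≤ p) :
    Filter.limsup
      (fun t : ℝ => ENNReal.ofReal (t ^ (1 - 1/p).toReal) * eLpNorm (Fheat μ t) p volume)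
      (𝓝[>] (0 : ℝ)) = 0 := by
  refine Tendsto.limsup_eq (tendsto_of_tendsto_of_tendsto_of_le_of_le' tendsto_const_nhds
    (tendsto_interactionMass μ) (.of_forall fun _ => zero_le) ?_)
  filter_upwards [self_mem_nhdsWithin] with t ht
  exact ofReal_rpow_mul_eLpNorm_le ht (enorm_Fheat_le μ ht) (lintegral_duhamelBound μ ht).le
    (duhamelBound_le μ ht) hp

end
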